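/- Let F = C_1 ∧ … ∧ C_m be an unsatisfiable CNF formula over n variables and let s, d be natural numbers. There is a tree-like resolution refutation of F of size at most s and depth at most d if and only if there is a decision tree of size at most s and depth at most d solving the falsified clause search problem Search(F). -/

import Mathlib

/-- A clause over `n` boolean variables: positive and negated literal index sets. -/
abbrev Clause (n : ℕ) := Finset (Fin n) × Finset (Fin n)

/-- An assignment `x` satisfies the clause `C = (P, N)` if `x i = true` for some `i ∈ P`
or `x i = false` for some `i ∈ N`; it falsifies `C` otherwise. -/
def Clause.Sat {n : ℕ} (C : Clause n) (x : Fin n → Bool) : Prop :=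
  (∃ i ∈ C.1, x i = true) ∨ (∃ i ∈ C.2, x i = false)

/-- A tree-like resolution proof of a clause from the CNF formula `F`: leaves are labelled
by clauses of `F`, binary nodes apply the resolution rule (children `A ∨ x_i` and `B ∨ ¬x_i`,
for a variable `i` whose literal does not occur in `A`, conclusion `A ∨ B`), and unary nodes
apply the weakening rule (child `A`, conclusion `A ∨ ℓ`). -/
inductive ResTree {n m : ℕ} (F : Fin m → Clause n) : Clause n → Type
  | leaf (j : Fin m) : ResTree F (F j)
  | res (A B : Clause n) (i : Fin n) (h : i ∉ A.1) :
      ResTree F (insert i A.1, A.2) → ResTree F (B.1, insert i B.2) →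
      ResTree F (A.1 ∪ B.1, A.2 ∪ B.2)
  | weakPos (C : Clause n) (i : Fin n) :
      ResTree F C → ResTree F (insert i C.1, C.2)
  | weakNeg (C : Clause n) (i : Fin n) :
      ResTree F C → ResTree F (C.1, insert i C.2)

namespace ResTree

/-- The size of a tree-like resolution proof: its number of nodes. -/
def size {n m : ℕ} {F : Fin m → Clause n} : {C : Clause n} → ResTree F C → ℕ
  | _, leaf _ => 1
  | _, res _ _ _ _ t u => t.size + u.size + 1
  | _, weakPos _ _ t => t.size + 1
  | _, weakNeg _ _ t => t.size + 1

/-- The depth of a tree-like resolution proof: the maximum number of edges on a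
root-to-leaf path. -/
def depth {n m : ℕ} {F : Fin m → Clause n} : {C : Clause n} → ResTree F C → ℕ
  | _, leaf _ => 0
  | _, res _ _ _ _ t u => max t.depth u.depth + 1
  | _, weakPos _ _ t => t.depth + 1
  | _, weakNeg _ _ t => t.depth + 1

end ResTree

/-- A decision tree over `n` boolean variables with outputs in `Fin m`. -/
inductive DecTree (n m : ℕ) : Type
  | leaf (o : Fin m)
  | node (i : Fin n) (t0 t1 : DecTree n m)

namespace DecTree

/-- Evaluate a decision tree on an input: at a node querying variable `i`, follow the
child corresponding to the value `x i`; output the label of the leaf reached. -/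
def eval {n m : ℕ} : DecTree n m → (Fin n → Bool) → Fin m
  | leaf o, _ => o
  | node i t0 t1, x => if x i then t1.eval x else t0.eval x

/-- The size of a decision tree: its number of nodes. -/
def size {n m : ℕ} : DecTree n m → ℕ
  | leaf _ => 1
  | node _ t0 t1 => t0.size + t1.size + 1

/-- The depth of a decision tree: the maximum number of edges on a root-to-leaf path. -/
def depth {n m : ℕ} : DecTree n m → ℕ
  | leaf _ => 0
  | node _ t0 t1 => max t0.depth t1.depth + 1

end DecTree

theorem Clause.Sat.mono {n : ℕ} {C D : Clause n} {x : Fin n → Bool} (h : C ≤ D)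
    (hC : C.Sat x) : D.Sat x :=
  hC.imp (fun ⟨i, hi, hx⟩ => ⟨i, h.1 hi, hx⟩) (fun ⟨i, hi, hx⟩ => ⟨i, h.2 hi, hx⟩)

/-- If every assignment falsifying a non-tautological clause `D` also falsifies `C`, then `C` is
a subclause of `D`. -/
theorem Clause.le_of_forall_not_sat {n : ℕ} {C D : Clause n} (hD : Disjoint D.1 D.2)
    (h : ∀ x, ¬ D.Sat x → ¬ C.Sat x) : C ≤ D := by
  rw [Finset.disjoint_left] at hD
  constructor
  · intro i hi
    by_contra hiD
    refine h (fun j => decide (j ∈ D.2 ∨ j = i)) ?_ (Or.inl ⟨i, hi, by simp⟩)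
    rintro (⟨j, hj, hx⟩ | ⟨j, hj, hx⟩)
    · rcases of_decide_eq_true hx with h2 | rfl
      · exact hD hj h2
      · exact hiD hj
    · exact of_decide_eq_false hx (Or.inl hj)
  · intro i hi
    by_contra hiD
    refine h (fun j => decide (j ∈ D.2)) ?_ (Or.inr ⟨i, hi, decide_eq_false hiD⟩)
    rintro (⟨j, hj, hx⟩ | ⟨j, hj, hx⟩)
    · exact hD hj (of_decide_eq_true hx)
    · exact of_decide_eq_false hx hj

/-- Resolving on a variable that occurs positively in `C` and negatively in `D`. -/
theorem ResTree.exists_resolvent {n m : ℕ} {F : Fin m → Clause n} {C D : Clause n} {i : Fin n}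
    (hC : i ∈ C.1) (hD : i ∈ D.2) (t : ResTree F C) (u : ResTree F D) :
    ∃ v : ResTree F (C.1.erase i ∪ D.1, C.2 ∪ D.2.erase i),
      v.size = t.size + u.size + 1 ∧ v.depth = max t.depth u.depth + 1 := by
  obtain ⟨P, N⟩ := C
  obtain ⟨P', N'⟩ := D
  obtain ⟨A, hA, rfl⟩ : ∃ A, i ∉ A ∧ insert i A = P :=
    ⟨P.erase i, Finset.notMem_erase i P, Finset.insert_erase hC⟩
  obtain ⟨B, hB, rfl⟩ : ∃ B, i ∉ B ∧ insert i B = N' :=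
    ⟨N'.erase i, Finset.notMem_erase i N', Finset.insert_erase hD⟩
  have eA := Finset.erase_insert hA
  have eB := Finset.erase_insert hB
  dsimp only
  rw [eA, eB]
  exact ⟨.res (A, N) (P', B) i hA t u, rfl, rfl⟩

/-- A tree-like resolution proof of `C` yields a decision tree, no larger and no deeper, that
finds a falsified clause on every input falsifying `C`. -/
theorem ResTree.exists_decTree {n m : ℕ} {F : Fin m → Clause n} {C : Clause n}
    (t : ResTree F C) : ∃ u : DecTree n m, (∀ x, ¬ C.Sat x → ¬ (F (u.eval x)).Sat x) ∧
      u.size ≤ t.size ∧ u.depth ≤ t.depth := by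
  induction t with
  | leaf j => exact ⟨.leaf j, fun _ h => h, le_rfl, le_rfl⟩
  | res A B i h t u iht ihu =>
    obtain ⟨t', ht, hts, htd⟩ := iht
    obtain ⟨u', hu, hus, hud⟩ := ihu
    refine ⟨.node i t' u', fun x hx => ?_, ?_, ?_⟩
    · cases hi : x i
      · simp only [DecTree.eval, hi, Bool.false_eq_true, if_false]
        refine ht x fun hs => hx ?_
        rcases hs with ⟨j, hj, hxj⟩ | ⟨j, hj, hxj⟩
        · rcases Finset.mem_insert.1 hj with rfl | hj
          · simp [hi] at hxj
          · exact Or.inl ⟨j, Finset.mem_union_left _ hj, hxj⟩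
        · exact Or.inr ⟨j, Finset.mem_union_left _ hj, hxj⟩
      · simp only [DecTree.eval, hi, if_true]
        refine hu x fun hs => hx ?_
        rcases hs with ⟨j, hj, hxj⟩ | ⟨j, hj, hxj⟩
        · exact Or.inl ⟨j, Finset.mem_union_right _ hj, hxj⟩
        · rcases Finset.mem_insert.1 hj with rfl | hj
          · simp [hi] at hxj
          · exact Or.inr ⟨j, Finset.mem_union_right _ hj, hxj⟩
    · simp only [DecTree.size, ResTree.size]; omega
    · simp only [DecTree.depth, ResTree.depth]; omega
  | weakPos C i t ih =>
    obtain ⟨u, hu, hs, hd⟩ := ih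
    exact ⟨u, fun x hx => hu x fun h => hx (h.mono ⟨Finset.subset_insert _ _, le_rfl⟩),
      Nat.le_succ_of_le hs, Nat.le_succ_of_le hd⟩
  | weakNeg C i t ih =>
    obtain ⟨u, hu, hs, hd⟩ := ih
    exact ⟨u, fun x hx => hu x fun h => hx (h.mono (C := C) ⟨le_rfl, Finset.subset_insert _ _⟩),
      Nat.le_succ_of_le hs, Nat.le_succ_of_le hd⟩

/-- A decision tree that finds a falsified clause on every input falsifying a non-tautological
clause `D` yields a tree-like resolution proof, no larger and no deeper, of a subclause of `D`. -/
theorem DecTree.exists_resTree {n m : ℕ} {F : Fin m → Clause n} (t : DecTree n m)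
    (D : Clause n) (hD : Disjoint D.1 D.2) (h : ∀ x, ¬ D.Sat x → ¬ (F (t.eval x)).Sat x) :
    ∃ C ≤ D, ∃ u : ResTree F C, u.size ≤ t.size ∧ u.depth ≤ t.depth := by
  induction t generalizing D with
  | leaf o => exact ⟨F o, Clause.le_of_forall_not_sat hD h, .leaf o, le_rfl, le_rfl⟩
  | node i t0 t1 ih0 ih1 =>
    simp only [DecTree.size, DecTree.depth]
    have eval_false : ∀ x : Fin n → Bool, x i = false →
        (DecTree.node i t0 t1).eval x = t0.eval x := fun x hx => by simp [DecTree.eval, hx]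
    have eval_true : ∀ x : Fin n → Bool, x i = true →
        (DecTree.node i t0 t1).eval x = t1.eval x := fun x hx => by simp [DecTree.eval, hx]
    by_cases hi1 : i ∈ D.1
    · obtain ⟨C, hC, u, hs, hd⟩ := ih0 D hD fun x hx => by
        rw [← eval_false x (Bool.eq_false_of_not_eq_true fun hxi => hx (Or.inl ⟨i, hi1, hxi⟩))]
        exact h x hx
      exact ⟨C, hC, u, by omega, by omega⟩
    by_cases hi2 : i ∈ D.2
    · obtain ⟨C, hC, u, hs, hd⟩ := ih1 D hD fun x hx => by
        rw [← eval_true x (Bool.eq_true_of_not_eq_false fun hxi => hx (Or.inr ⟨i, hi2, hxi⟩))]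
        exact h x hx
      exact ⟨C, hC, u, by omega, by omega⟩
    obtain ⟨C0, hC0, u0, hs0, hd0⟩ := ih0 (insert i D.1, D.2)
      (Finset.disjoint_insert_left.2 ⟨hi2, hD⟩) fun x hx => by
        rw [← eval_false x (Bool.eq_false_of_not_eq_true fun hxi =>
          hx (Or.inl ⟨i, Finset.mem_insert_self _ _, hxi⟩))]
        exact h x fun hs => hx (hs.mono ⟨Finset.subset_insert _ _, le_rfl⟩)
    obtain ⟨C1, hC1, u1, hs1, hd1⟩ := ih1 (D.1, insert i D.2)
      (Finset.disjoint_insert_right.2 ⟨hi1, hD⟩) fun x hx => by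
        rw [← eval_true x (Bool.eq_true_of_not_eq_false fun hxi =>
          hx (Or.inr ⟨i, Finset.mem_insert_self _ _, hxi⟩))]
        exact h x fun hs => hx (hs.mono (C := D) ⟨le_rfl, Finset.subset_insert _ _⟩)
    by_cases h0 : i ∈ C0.1
    · by_cases h1 : i ∈ C1.2
      · obtain ⟨v, hvs, hvd⟩ := ResTree.exists_resolvent h0 h1 u0 u1
        exact ⟨_, ⟨Finset.union_subset (Finset.subset_insert_iff.1 hC0.1) hC1.1,
          Finset.union_subset hC0.2 (Finset.subset_insert_iff.1 hC1.2)⟩, v,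
          by omega, by omega⟩
      · exact ⟨C1, ⟨hC1.1, (Finset.subset_insert_iff_of_notMem h1).1 hC1.2⟩, u1,
          by omega, by omega⟩
    · exact ⟨C0, ⟨(Finset.subset_insert_iff_of_notMem h0).1 hC0.1, hC0.2⟩, u0,
        by omega, by omega⟩

/-- For an unsatisfiable CNF formula `F`, there is a size-`≤ s`, depth-`≤ d` tree-like
resolution refutation of `F` if and only if there is a size-`≤ s`, depth-`≤ d`
decision tree solving the falsified clause search problem `Search(F)`. -/
theorem treelike_resolution_iff_decision_tree {n m : ℕ} (F : Fin m → Clause n)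
    (hunsat : ¬ ∃ x : Fin n → Bool, ∀ j, (F j).Sat x) (s d : ℕ) :
    (∃ t : ResTree F ((∅, ∅) : Clause n), t.size ≤ s ∧ t.depth ≤ d) ↔
    (∃ t : DecTree n m, (∀ x : Fin n → Bool, ¬ (F (t.eval x)).Sat x) ∧
      t.size ≤ s ∧ t.depth ≤ d) := by
  constructor
  · rintro ⟨t, hs, hd⟩
    obtain ⟨u, hu, hus, hud⟩ := t.exists_decTree
    exact ⟨u, fun x => hu x (by simp [Clause.Sat]), hus.trans hs, hud.trans hd⟩
  · rintro ⟨t, ht, hs, hd⟩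
    obtain ⟨C, hC, u, hus, hud⟩ :=
      t.exists_resTree (∅, ∅) (Finset.disjoint_empty_left _) fun x _ => ht x
    obtain rfl : C = (∅, ∅) :=
      Prod.ext (Finset.subset_empty.1 hC.1) (Finset.subset_empty.1 hC.2)
    exact ⟨u, hus.trans hs, hud.trans hd⟩
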